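/- The number of pairs (A, B), where A is a deterministic Alice strategy and B is a deterministic Bob strategy for the Magic Square game, such that the cardinality of {(x, y) ∈ Fin 3 × Fin 3 : A x y = B y x} equals 8, is exactly 144 (= 9 × 2⁴). -/

import Mathlib

/-- The `3 × 3` matrix over `ZMod 2` with rows summing to `0`, columns `y` summing to
`1 + [y = y₀]`, and upper left `2 × 2` block `a, b, c, d`. -/
def magicSquareMatrix (y₀ : Fin 3) (a b c d : ZMod 2) : Fin 3 → Fin 3 → ZMod 2 :=
  let r : Fin 3 → ZMod 2 := fun y => 1 + if y = y₀ then 1 else 0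
  ![![a, b, a + b], ![c, d, c + d], ![r 0 + a + c, r 1 + b + d, r 2 + (a + b) + (c + d)]]

/-- The strategy pair losing exactly at `p`, with the given upper left block for Alice. -/
def magicSquarePair (q : (Fin 3 × Fin 3) × ZMod 2 × ZMod 2 × ZMod 2 × ZMod 2) :
    (Fin 3 → Fin 3 → ZMod 2) × (Fin 3 → Fin 3 → ZMod 2) :=
  let A := magicSquareMatrix q.1.2 q.2.1 q.2.2.1 q.2.2.2.1 q.2.2.2.2
  (A, fun y x => A x y + if (x, y) = q.1 then 1 else 0)

theorem magicSquarePair_injective : Function.Injective magicSquarePair := by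
  rintro ⟨p, a, b, c, d⟩ ⟨p', a', b', c', d'⟩ h
  have hA := congrArg Prod.fst h
  have hB := congrFun (congrFun (congrArg Prod.snd h) p.2) p.1
  have ha : a = a' := congrFun (congrFun hA 0) 0
  have hb : b = b' := congrFun (congrFun hA 0) 1
  have hc : c = c' := congrFun (congrFun hA 1) 0
  have hd : d = d' := congrFun (congrFun hA 1) 1
  have hp : p = p' := by
    simp only [magicSquarePair] at hA hB
    rw [hA] at hB
    by_contra hne
    simp [hne] at hB
  subst ha hb hc hd hp
  rfl

theorem magicSquareMatrix_row_sum (y₀ : Fin 3) (a b c d : ZMod 2) (x : Fin 3) :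
    magicSquareMatrix y₀ a b c d x 0 + magicSquareMatrix y₀ a b c d x 1 +
      magicSquareMatrix y₀ a b c d x 2 = 0 := by
  revert y₀ a b c d x
  decide

theorem magicSquarePair_col_sum (p : Fin 3 × Fin 3) (a b c d : ZMod 2) (y : Fin 3) :
    (magicSquarePair (p, a, b, c, d)).2 y 0 + (magicSquarePair (p, a, b, c, d)).2 y 1 +
      (magicSquarePair (p, a, b, c, d)).2 y 2 = 1 := by
  revert p a b c d y
  decide

theorem magicSquarePair_card_wins (q : (Fin 3 × Fin 3) × ZMod 2 × ZMod 2 × ZMod 2 × ZMod 2) :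
    (Finset.univ.filter (fun p : Fin 3 × Fin 3 =>
      (magicSquarePair q).1 p.1 p.2 = (magicSquarePair q).2 p.2 p.1)).card = 8 := by
  have h : (Finset.univ.filter (fun p : Fin 3 × Fin 3 =>
      (magicSquarePair q).1 p.1 p.2 = (magicSquarePair q).2 p.2 p.1)) = {q.1}ᶜ := by
    ext p
    simp [magicSquarePair]
  rw [h, Finset.card_compl]
  simp

theorem ZMod.eq_add_one_of_ne {u v : ZMod 2} (h : u ≠ v) : v = u + 1 := by
  revert u v
  decide

theorem exists_unique_loss {A B : Fin 3 → Fin 3 → ZMod 2}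
    (h : (Finset.univ.filter (fun p : Fin 3 × Fin 3 => A p.1 p.2 = B p.2 p.1)).card = 8) :
    ∃ p : Fin 3 × Fin 3, ∀ y x, B y x = A x y + if (x, y) = p then 1 else 0 := by
  have hc : (Finset.univ.filter (fun p : Fin 3 × Fin 3 => A p.1 p.2 = B p.2 p.1))ᶜ.card = 1 := by
    rw [Finset.card_compl, h]
    simp
  obtain ⟨p, hp⟩ := Finset.card_eq_one.mp hc
  refine ⟨p, fun y x => ?_⟩
  have hxy : A x y ≠ B y x ↔ (x, y) = p := by
    simpa using Finset.ext_iff.mp hp (x, y)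
  split_ifs with he
  · exact ZMod.eq_add_one_of_ne (hxy.mpr he)
  · rw [add_zero]
    exact (not_not.mp (mt hxy.mp he)).symm

theorem ZMod.eq_add_of_add_add_eq {a b c r : ZMod 2} (h : a + b + c = r) : c = r + a + b := by
  revert a b c r
  decide

theorem eq_magicSquareMatrix {A : Fin 3 → Fin 3 → ZMod 2} {y₀ : Fin 3}
    (hr : ∀ x, A x 0 + A x 1 + A x 2 = 0)
    (hc : ∀ y, A 0 y + A 1 y + A 2 y = 1 + if y = y₀ then 1 else 0) :
    magicSquareMatrix y₀ (A 0 0) (A 0 1) (A 1 0) (A 1 1) = A := by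
  have h02 : A 0 2 = A 0 0 + A 0 1 := by simpa using ZMod.eq_add_of_add_add_eq (hr 0)
  have h12 : A 1 2 = A 1 0 + A 1 1 := by simpa using ZMod.eq_add_of_add_add_eq (hr 1)
  have h2 (y : Fin 3) := ZMod.eq_add_of_add_add_eq (hc y)
  funext x y
  fin_cases x <;> fin_cases y
  · rfl
  · rfl
  · exact h02.symm
  · rfl
  · rfl
  · exact h12.symm
  · exact (h2 0).symm
  · exact (h2 1).symm
  · exact (h02 ▸ h12 ▸ h2 2).symm

theorem exists_magicSquarePair_eq {A B : Fin 3 → Fin 3 → ZMod 2}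
    (hA : ∀ x, A x 0 + A x 1 + A x 2 = 0) (hB : ∀ y, B y 0 + B y 1 + B y 2 = 1)
    (h : (Finset.univ.filter (fun p : Fin 3 × Fin 3 => A p.1 p.2 = B p.2 p.1)).card = 8) :
    ∃ q, magicSquarePair q = (A, B) := by
  obtain ⟨⟨x₀, y₀⟩, hp⟩ := exists_unique_loss h
  have hc (y : Fin 3) : A 0 y + A 1 y + A 2 y = 1 + if y = y₀ then 1 else 0 := by
    have hsum : (∑ x : Fin 3, if (x, y) = (x₀, y₀) then (1 : ZMod 2) else 0) =
        if y = y₀ then 1 else 0 := by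
      by_cases hy : y = y₀ <;> simp [hy]
    have hBy := hB y
    rw [hp, hp, hp] at hBy
    rw [Fin.sum_univ_three] at hsum
    linear_combination hBy - hsum - CharTwo.add_self_eq_zero (if y = y₀ then (1 : ZMod 2) else 0)
  refine ⟨((x₀, y₀), A 0 0, A 0 1, A 1 0, A 1 1), ?_⟩
  simp only [magicSquarePair, eq_magicSquareMatrix hA hc, ← hp]

/-- **There are exactly 144 optimal deterministic strategies.**
The number of pairs `(A, B)` of deterministic Alice and Bob strategies for the
Magic Square game (rows of `A` summing to `0`, columns of `B` summing to `1`
mod 2) that win on exactly 8 of the 9 input pairs is `144 = 9 × 2⁴`. -/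
theorem magic_square_optimal_strategies_card :
    (Finset.univ.filter
      (fun s : (Fin 3 → Fin 3 → ZMod 2) × (Fin 3 → Fin 3 → ZMod 2) =>
        (∀ x : Fin 3, s.1 x 0 + s.1 x 1 + s.1 x 2 = 0) ∧
        (∀ y : Fin 3, s.2 y 0 + s.2 y 1 + s.2 y 2 = 1) ∧
        (Finset.univ.filter (fun p : Fin 3 × Fin 3 => s.1 p.1 p.2 = s.2 p.2 p.1)).card = 8)).card
      = 144 := by
  have himage : (Finset.univ.filter
      (fun s : (Fin 3 → Fin 3 → ZMod 2) × (Fin 3 → Fin 3 → ZMod 2) =>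
        (∀ x : Fin 3, s.1 x 0 + s.1 x 1 + s.1 x 2 = 0) ∧
        (∀ y : Fin 3, s.2 y 0 + s.2 y 1 + s.2 y 2 = 1) ∧
        (Finset.univ.filter (fun p : Fin 3 × Fin 3 => s.1 p.1 p.2 = s.2 p.2 p.1)).card = 8)) =
      Finset.univ.image magicSquarePair := by
    ext s
    simp only [Finset.mem_filter_univ, Finset.mem_image, Finset.mem_univ, true_and]
    constructor
    · rintro ⟨hA, hB, h⟩
      exact exists_magicSquarePair_eq hA hB h
    · rintro ⟨q, rfl⟩
      exact ⟨magicSquareMatrix_row_sum _ _ _ _ _, magicSquarePair_col_sum _ _ _ _ _,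
        magicSquarePair_card_wins q⟩
  rw [himage, Finset.card_image_of_injective _ magicSquarePair_injective]
  simp [ZMod.card]
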